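/- arXiv:2109.09078 — 2 statements merged into one kernel-verified Lean document; each statement's English description precedes it below -/
import Mathlib

section
/- Monotonicity of Gaussian trade-off functions: for all real numbers 0 ≤ μ₁ ≤ μ₂ and all α ∈ [0,1], G_{μ₂}(α) ≤ G_{μ₁}(α), where G_μ(α) := T(𝒩(0,1), 𝒩(μ,1))(α) and 𝒩(μ, σ²) denotes the Gaussian probability measure on ℝ with mean μ and variance σ². Consequently, for any finite family μ₁,…,μ_k ≥ 0, the pointwise minimum of G_{μ₁},…,G_{μ_k} equals G_{max{μ₁,…,μ_k}}. -/
open MeasureTheory ProbabilityTheory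

/-- The trade-off function `T(P, P')(α)`: the infimum of type-II errors
`1 - ∫ φ dP'` over measurable rejection rules `0 ≤ φ ≤ 1` with type-I error
`∫ φ dP ≤ α`. -/
noncomputable def tradeOff {Ω : Type*} [MeasurableSpace Ω] (P P' : Measure Ω) (α : ℝ) : ℝ :=
  sInf {β : ℝ | ∃ φ : Ω → ℝ, Measurable φ ∧ (∀ ω, φ ω ∈ Set.Icc (0 : ℝ) 1) ∧
    (∫ ω, φ ω ∂P) ≤ α ∧ β = 1 - ∫ ω, φ ω ∂P'}

/-- The Gaussian trade-off function `G_μ = T(𝒩(0,1), 𝒩(μ,1))`. -/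
noncomputable def gaussTradeOff (μ : ℝ) (α : ℝ) : ℝ :=
  tradeOff (gaussianReal 0 1) (gaussianReal μ 1) α

theorem tradeOff_le_of_forall_exists_test {Ω Ω' : Type*} [MeasurableSpace Ω] [MeasurableSpace Ω']
    {P P' : Measure Ω} {Q Q' : Measure Ω'} [IsProbabilityMeasure P'] {α : ℝ} (hα : 0 ≤ α)
    (h : ∀ φ : Ω' → ℝ, Measurable φ → (∀ ω, φ ω ∈ Set.Icc (0 : ℝ) 1) →
      ∃ ψ : Ω → ℝ, Measurable ψ ∧ (∀ ω, ψ ω ∈ Set.Icc (0 : ℝ) 1) ∧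
        ∫ ω, ψ ω ∂P = ∫ ω, φ ω ∂Q ∧ ∫ ω, ψ ω ∂P' = ∫ ω, φ ω ∂Q') :
    tradeOff P P' α ≤ tradeOff Q Q' α := by
  refine csInf_le_csInf ⟨0, ?_⟩ ⟨1, fun _ => 0, measurable_const, by simp, by simpa, by simp⟩ ?_
  · rintro _ ⟨φ, -, hφ, -, rfl⟩
    have : ∫ ω, φ ω ∂P' ≤ ∫ _, (1 : ℝ) ∂P' :=
      integral_mono_of_nonneg (.of_forall fun ω => (hφ ω).1) (integrable_const 1)
        (.of_forall fun ω => (hφ ω).2)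
    simpa using this
  · rintro _ ⟨φ, hm, hφ, hle, rfl⟩
    obtain ⟨ψ, hψm, hψ, hP, hP'⟩ := h φ hm hφ
    exact ⟨ψ, hψm, hψ, hP.trans_le hle, by rw [hP']⟩

/-- Data processing inequality for a deterministic map. -/
theorem tradeOff_le_tradeOff_map {Ω Ω' : Type*} [MeasurableSpace Ω] [MeasurableSpace Ω']
    (P P' : Measure Ω) [IsProbabilityMeasure P'] {f : Ω → Ω'} (hf : Measurable f)
    {α : ℝ} (hα : 0 ≤ α) :
    tradeOff P P' α ≤ tradeOff (P.map f) (P'.map f) α :=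
  tradeOff_le_of_forall_exists_test hα fun φ hm hφ =>
    ⟨φ ∘ f, hm.comp hf, fun ω => hφ (f ω),
      (integral_map hf.aemeasurable hm.aestronglyMeasurable).symm,
      (integral_map hf.aemeasurable hm.aestronglyMeasurable).symm⟩

/-- Data processing inequality for the addition of independent noise. -/
theorem tradeOff_le_tradeOff_conv {M : Type*} [AddMonoid M] [MeasurableSpace M] [MeasurableAdd₂ M]
    (P P' ν : Measure M) [IsProbabilityMeasure P] [IsProbabilityMeasure P']
    [IsProbabilityMeasure ν] {α : ℝ} (hα : 0 ≤ α) :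
    tradeOff P P' α ≤ tradeOff (P.conv ν) (P'.conv ν) α := by
  refine tradeOff_le_of_forall_exists_test hα fun φ hm hφ => ?_
  have hint (Q : Measure M) [IsProbabilityMeasure Q] : Integrable φ Q :=
    .of_mem_Icc 0 1 hm.aemeasurable (.of_forall hφ)
  refine ⟨fun x => ∫ y, φ (x + y) ∂ν, ?_, fun x => ⟨integral_nonneg fun y => (hφ _).1, ?_⟩,
    (integral_conv (hint _)).symm, (integral_conv (hint _)).symm⟩
  · exact (hm.comp measurable_add).stronglyMeasurable.integral_prod_right'.measurable
  · have : ∫ y, φ (x + y) ∂ν ≤ ∫ _, (1 : ℝ) ∂ν :=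
      integral_mono_of_nonneg (.of_forall fun y => (hφ _).1) (integrable_const 1)
        (.of_forall fun y => (hφ _).2)
    simpa using this

theorem map_const_mul_conv_gaussianReal {r : ℝ} (hr : r ^ 2 ≤ 1) (m : ℝ) :
    ((gaussianReal m 1).map (r * ·)).conv (gaussianReal 0 (.mk (1 - r ^ 2) (sub_nonneg.2 hr))) =
      gaussianReal (r * m) 1 := by
  rw [gaussianReal_map_const_mul, gaussianReal_conv_gaussianReal, add_zero]
  congr 1
  ext
  simp

theorem gaussTradeOff_le_of_le {μ₁ μ₂ : ℝ} (h₁ : 0 ≤ μ₁) (h : μ₁ ≤ μ₂) {α : ℝ} (hα : 0 ≤ α) :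
    gaussTradeOff μ₂ α ≤ gaussTradeOff μ₁ α := by
  obtain rfl | h₂ := (h₁.trans h).eq_or_lt
  · rw [le_antisymm h h₁]
  have hr : (μ₁ / μ₂) ^ 2 ≤ 1 := pow_le_one₀ (by positivity) ((div_le_one h₂).2 h)
  have hmul : Measurable (μ₁ / μ₂ * · : ℝ → ℝ) := measurable_const_mul _
  have (m : ℝ) : IsProbabilityMeasure ((gaussianReal m 1).map (μ₁ / μ₂ * ·)) :=
    Measure.isProbabilityMeasure_map hmul.aemeasurable
  have key := (tradeOff_le_tradeOff_map (gaussianReal 0 1) (gaussianReal μ₂ 1) hmul hα).trans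
    (tradeOff_le_tradeOff_conv _ _ (gaussianReal 0 (.mk (1 - (μ₁ / μ₂) ^ 2) (sub_nonneg.2 hr))) hα)
  rwa [map_const_mul_conv_gaussianReal hr, map_const_mul_conv_gaussianReal hr, mul_zero,
    div_mul_cancel₀ _ h₂.ne'] at key

/-- Monotonicity of Gaussian trade-off functions: for `0 ≤ μ₁ ≤ μ₂` and `α ∈ [0,1]`,
`G_{μ₂}(α) ≤ G_{μ₁}(α)`. Consequently, for any finite family `μ₁, …, μ_k ≥ 0`, the
pointwise minimum of `G_{μ₁}, …, G_{μ_k}` equals `G_{max μᵢ}`. -/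
theorem gaussTradeOff_antitone_and_min_eq_max :
    (∀ μ₁ μ₂ : ℝ, 0 ≤ μ₁ → μ₁ ≤ μ₂ → ∀ α ∈ Set.Icc (0 : ℝ) 1,
      gaussTradeOff μ₂ α ≤ gaussTradeOff μ₁ α) ∧
    (∀ (k : ℕ) (hk : 0 < k) (μ : Fin k → ℝ), (∀ i, 0 ≤ μ i) →
      ∀ α ∈ Set.Icc (0 : ℝ) 1,
        Finset.univ.inf' ⟨⟨0, hk⟩, Finset.mem_univ _⟩ (fun i => gaussTradeOff (μ i) α) =
          gaussTradeOff (Finset.univ.sup' ⟨⟨0, hk⟩, Finset.mem_univ _⟩ μ) α) := by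
  refine ⟨fun μ₁ μ₂ h₁ h α hα => gaussTradeOff_le_of_le h₁ h hα.1,
    fun k hk μ hμ α hα => le_antisymm ?_ ?_⟩
  · obtain ⟨i, -, hi⟩ := Finset.exists_mem_eq_sup' ⟨⟨0, hk⟩, Finset.mem_univ _⟩ μ
    rw [hi]
    exact Finset.inf'_le _ (Finset.mem_univ i)
  · exact Finset.le_inf' _ _ fun i _ =>
      gaussTradeOff_le_of_le (hμ i) (Finset.le_sup' μ (Finset.mem_univ i)) hα.1
end

section
/- Parallel composition for Gaussian differential privacy (non-adaptive form): Let 𝔻₁ and 𝔻₂ be disjoint subsets of the row set X, and for i = 1, 2 let Mᵢ map data sets to probability measures on measurable spaces Rᵢ with, for all neighboring D, D′ and all α ∈ [0,1], T(Mᵢ(D ∩ 𝔻ᵢ), Mᵢ(D′ ∩ 𝔻ᵢ))(α) ≥ G_{μᵢ}(α), where μ₁, μ₂ ≥ 0. Then the joint mechanism M(D) := M₁(D ∩ 𝔻₁) × M₂(D ∩ 𝔻₂) satisfies T(M(D), M(D′))(α) ≥ G_{max(μ₁,μ₂)}(α) for all neighboring D, D′ and all α ∈ [0,1]. -/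
open MeasureTheory ProbabilityTheory

/-- Two data sets (finite multisets over the row set `X`) are neighboring if one is
obtained from the other by adding a single row. -/
def Neighboring {X : Type*} (D D' : Multiset X) : Prop :=
  ∃ x : X, D' = D + {x} ∨ D = D' + {x}

theorem integral_le_one_of_mem_Icc {Ω : Type*} [MeasurableSpace Ω] (P : Measure Ω)
    [IsProbabilityMeasure P] {φ : Ω → ℝ} (hφ : ∀ ω, φ ω ∈ Set.Icc (0 : ℝ) 1) :
    ∫ ω, φ ω ∂P ≤ 1 := by
  have h := integral_mono_of_nonneg (μ := P) (.of_forall fun ω => (hφ ω).1)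
    (integrable_const (1 : ℝ)) (.of_forall fun ω => (hφ ω).2)
  simpa using h

/-- A trade-off function can only increase under post-processing with independent randomness. -/
theorem tradeOff_le_tradeOff_map_prod {Ω Ω' Ω'' : Type*} [MeasurableSpace Ω]
    [MeasurableSpace Ω'] [MeasurableSpace Ω''] (P P' : Measure Ω) (Q : Measure Ω')
    [IsProbabilityMeasure P] [IsProbabilityMeasure P'] [IsProbabilityMeasure Q]
    {f : Ω × Ω' → Ω''} (hf : Measurable f) {α : ℝ} (hα : 0 ≤ α) :
    tradeOff P P' α ≤ tradeOff ((P.prod Q).map f) ((P'.prod Q).map f) α := by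
  refine le_csInf ⟨1, fun _ => 0, measurable_const, by simp, by simpa using hα, by simp⟩ ?_
  rintro β ⟨φ, hφ, hφ01, hφα, rfl⟩
  have hφf : Measurable (φ ∘ f) := hφ.comp hf
  have integral_eq (μ : Measure Ω) [IsProbabilityMeasure μ] :
      ∫ ω, φ ω ∂((μ.prod Q).map f) = ∫ x, ∫ y, φ (f (x, y)) ∂Q ∂μ := by
    rw [integral_map hf.aemeasurable hφ.aestronglyMeasurable]
    exact integral_prod _ (Integrable.of_mem_Icc 0 1 hφf.aemeasurable
      (.of_forall fun p => hφ01 (f p)))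
  refine csInf_le ⟨0, ?_⟩ ⟨fun x => ∫ y, φ (f (x, y)) ∂Q,
    hφf.stronglyMeasurable.integral_prod_right'.measurable, fun x => ⟨?_, ?_⟩, ?_, ?_⟩
  · rintro β ⟨ψ, -, hψ01, -, rfl⟩
    exact sub_nonneg.2 (integral_le_one_of_mem_Icc P' hψ01)
  · exact integral_nonneg fun y => (hφ01 _).1
  · exact integral_le_one_of_mem_Icc Q fun y => hφ01 _
  · rwa [← integral_eq]
  · rw [integral_eq]

theorem gaussianReal_prod_map_add_mul (m c s : ℝ) (h : c ^ 2 + s ^ 2 = 1) :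
    ((gaussianReal m 1).prod (gaussianReal 0 1)).map (fun p => c * p.1 + s * p.2) =
      gaussianReal (c * m) 1 := by
  have hcomp : (fun p : ℝ × ℝ => c * p.1 + s * p.2) =
      (fun p : ℝ × ℝ => p.1 + p.2) ∘ Prod.map (c * ·) (s * ·) := rfl
  rw [hcomp, ← Measure.map_map (by fun_prop) (by fun_prop),
    ← Measure.map_prod_map _ _ (by fun_prop) (by fun_prop),
    gaussianReal_map_const_mul, gaussianReal_map_const_mul]
  change Measure.conv _ _ = _
  rw [gaussianReal_conv_gaussianReal]
  congr 1
  · simp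
  · ext
    simpa using h

theorem gaussTradeOff_anti {μ ν α : ℝ} (hμ : 0 ≤ μ) (hμν : μ ≤ ν) (hα : 0 ≤ α) :
    gaussTradeOff ν α ≤ gaussTradeOff μ α := by
  obtain rfl | hν := (hμ.trans hμν).eq_or_lt
  · rw [le_antisymm hμν hμ]
  have hc : (μ / ν) ^ 2 ≤ 1 := pow_le_one₀ (by positivity) (div_le_one_of_le₀ hμν hν.le)
  have hs : (μ / ν) ^ 2 + √(1 - (μ / ν) ^ 2) ^ 2 = 1 := by
    rw [Real.sq_sqrt (by linarith)]
    ring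
  have h := tradeOff_le_tradeOff_map_prod (gaussianReal 0 1) (gaussianReal ν 1)
    (gaussianReal 0 1) (f := fun p => μ / ν * p.1 + √(1 - (μ / ν) ^ 2) * p.2)
    (by fun_prop) hα
  rwa [gaussianReal_prod_map_add_mul _ _ _ hs, gaussianReal_prod_map_add_mul _ _ _ hs,
    mul_zero, div_mul_cancel₀ _ hν.ne'] at h

theorem Neighboring.filter_eq_or_filter_eq {X : Type*} {D D' : Multiset X}
    (h : Neighboring D D') {s t : Set X} [DecidablePred (· ∈ s)] [DecidablePred (· ∈ t)]
    (hst : Disjoint s t) :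
    D.filter (· ∈ s) = D'.filter (· ∈ s) ∨ D.filter (· ∈ t) = D'.filter (· ∈ t) := by
  obtain ⟨x, hx⟩ := h
  by_cases hxs : x ∈ s
  · have hxt : x ∉ t := Set.disjoint_left.1 hst hxs
    right
    rcases hx with rfl | rfl <;> simp [Multiset.filter_add, Multiset.filter_singleton, hxt]
  · left
    rcases hx with rfl | rfl <;> simp [Multiset.filter_add, Multiset.filter_singleton, hxs]

/-- Parallel composition for Gaussian differential privacy (non-adaptive form): if
`M₁` restricted to `𝔻₁` is `μ₁`-GDP and `M₂` restricted to `𝔻₂` is `μ₂`-GDP, with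
`𝔻₁, 𝔻₂` disjoint, then the joint mechanism `D ↦ M₁(D ∩ 𝔻₁) × M₂(D ∩ 𝔻₂)` is
`max(μ₁, μ₂)`-GDP. -/
theorem parallel_composition_GDP {X R₁ R₂ : Type*}
    [MeasurableSpace R₁] [MeasurableSpace R₂]
    (𝔻₁ 𝔻₂ : Set X) [DecidablePred (· ∈ 𝔻₁)] [DecidablePred (· ∈ 𝔻₂)]
    (hdisj : Disjoint 𝔻₁ 𝔻₂)
    (M₁ : Multiset X → Measure R₁) (M₂ : Multiset X → Measure R₂)
    [∀ D, IsProbabilityMeasure (M₁ D)] [∀ D, IsProbabilityMeasure (M₂ D)]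
    (μ₁ μ₂ : ℝ) (hμ₁ : 0 ≤ μ₁) (hμ₂ : 0 ≤ μ₂)
    (hM₁ : ∀ D D' : Multiset X, Neighboring D D' → ∀ α ∈ Set.Icc (0 : ℝ) 1,
      gaussTradeOff μ₁ α ≤ tradeOff (M₁ (D.filter (· ∈ 𝔻₁))) (M₁ (D'.filter (· ∈ 𝔻₁))) α)
    (hM₂ : ∀ D D' : Multiset X, Neighboring D D' → ∀ α ∈ Set.Icc (0 : ℝ) 1,
      gaussTradeOff μ₂ α ≤ tradeOff (M₂ (D.filter (· ∈ 𝔻₂))) (M₂ (D'.filter (· ∈ 𝔻₂))) α) :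
    ∀ D D' : Multiset X, Neighboring D D' → ∀ α ∈ Set.Icc (0 : ℝ) 1,
      gaussTradeOff (max μ₁ μ₂) α ≤
        tradeOff ((M₁ (D.filter (· ∈ 𝔻₁))).prod (M₂ (D.filter (· ∈ 𝔻₂))))
          ((M₁ (D'.filter (· ∈ 𝔻₁))).prod (M₂ (D'.filter (· ∈ 𝔻₂)))) α := by
  intro D D' hDD' α hα
  obtain h | h := hDD'.filter_eq_or_filter_eq hdisj
  · refine (gaussTradeOff_anti hμ₂ (le_max_right μ₁ μ₂) hα.1).trans
      ((hM₂ D D' hDD' α hα).trans ?_)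
    rw [← h, ← Measure.prod_swap (μ := M₂ (D.filter (· ∈ 𝔻₂))),
      ← Measure.prod_swap (μ := M₂ (D'.filter (· ∈ 𝔻₂)))]
    exact tradeOff_le_tradeOff_map_prod _ _ _ measurable_swap hα.1
  · refine (gaussTradeOff_anti hμ₁ (le_max_left μ₁ μ₂) hα.1).trans
      ((hM₁ D D' hDD' α hα).trans ?_)
    rw [← h]
    simpa using tradeOff_le_tradeOff_map_prod (M₁ (D.filter (· ∈ 𝔻₁)))
      (M₁ (D'.filter (· ∈ 𝔻₁))) (M₂ (D.filter (· ∈ 𝔻₂))) measurable_id hα.1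
end
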